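/- Let S be a relation of weight k ≤ 12 that is stable under complex conjugation (i.e., S(η⁻¹) = S(η) for every root of unity η). Then S admits a decomposition as a sum of minimal relations (a finite multiset of minimal relations whose pointwise sum is S) such that the multiset is stable under complex conjugation: each minimal relation occurring is itself stable under complex conjugation, or can be paired with another minimal relation occurring in the decomposition which is its complex conjugate. -/

import Mathlib

noncomputable section

/-- A relation: a finitely supported function from roots of unity to `ℕ`,
not identically zero, whose weighted sum of roots of unity is zero. -/
structure ZeroRelation where
  coeff : ℂ →₀ ℕ
  mem_rootsOfUnity : ∀ z ∈ coeff.support, ∃ m : ℕ, 0 < m ∧ z ^ m = 1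
  ne_zero : coeff ≠ 0
  sum_zero : (coeff.sum fun z c => (c : ℂ) * z) = 0

/-- The weight of a relation: the sum of its coefficients. -/
def ZeroRelation.weight (a : ZeroRelation) : ℕ := a.coeff.sum fun _ c => c

/-- A relation is minimal if it has no nontrivial subrelation. -/
def ZeroRelation.IsMinimal (a : ZeroRelation) : Prop :=
  ∀ b : ℂ →₀ ℕ, (∀ z, b z ≤ a.coeff z) →
    (b.sum fun z c => (c : ℂ) * z) = 0 → b = 0 ∨ b = a.coeff

/-- Galois conjugation `y ↦ y ^ u` preserves vanishing sums of `N`-th roots of unity. -/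
theorem sum_mul_pow_eq_zero_of_coprime {ι : Type*} {s : Finset ι} {a : ι → ℕ} {y : ι → ℂ}
    {N u : ℕ} (hN : 0 < N) (hy : ∀ i ∈ s, y i ^ N = 1) (hu : u.Coprime N)
    (h : ∑ i ∈ s, (a i : ℂ) * y i = 0) : ∑ i ∈ s, (a i : ℂ) * y i ^ u = 0 := by
  classical
  have : NeZero N := ⟨hN.ne'⟩
  have hξ := Complex.isPrimitiveRoot_exp N hN.ne'
  set ξ := Complex.exp (2 * Real.pi * Complex.I / N)
  have hk : ∀ i, ∃ k : ℕ, i ∈ s → ξ ^ k = y i := fun i => by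
    by_cases hi : i ∈ s
    · obtain ⟨k, -, hk⟩ := hξ.eq_pow_of_pow_eq_one (hy i hi)
      exact ⟨k, fun _ => hk⟩
    · exact ⟨0, fun h => absurd h hi⟩
  choose k hk using hk
  let q : Polynomial ℤ := ∑ i ∈ s, (a i : Polynomial ℤ) * Polynomial.X ^ k i
  have hq : ∀ x : ℂ, Polynomial.aeval x q = ∑ i ∈ s, (a i : ℂ) * x ^ k i := fun x => by
    simp [q]
  have h0 : Polynomial.aeval ξ q = 0 := by
    rw [hq, ← h]
    exact Finset.sum_congr rfl fun i hi => by rw [hk i hi]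
  have hdvd := minpoly.isIntegrallyClosed_dvd (hξ.isIntegral hN) h0
  rw [hξ.minpoly_eq_pow_coprime hu] at hdvd
  have h1 : Polynomial.aeval (ξ ^ u) q = 0 := by
    obtain ⟨r, hr⟩ := hdvd
    rw [hr, map_mul, minpoly.aeval, zero_mul]
  rw [hq] at h1
  rw [← h1]
  exact Finset.sum_congr rfl fun i hi => by rw [← hk i hi, ← pow_mul, ← pow_mul, mul_comm (k i)]

/-- Fourier inversion, expressing the part of a sum over one fibre of `z ↦ z ^ m`. -/
theorem natCast_mul_sum_filter_pow_eq {s : Finset ℂ} {a : ℂ → ℕ} {p m : ℕ} {z₀ : ℂ}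
    (hz₀ : z₀ ≠ 0) (hs : ∀ z ∈ s, z ^ (p * m) = z₀ ^ (p * m)) :
    (p : ℂ) * ∑ z ∈ s with z ^ m = z₀ ^ m, (a z : ℂ) * z =
      ∑ t ∈ Finset.range p, ∑ z ∈ s, (a z : ℂ) * z * (z / z₀) ^ (m * t) := by
  rw [Finset.sum_comm, Finset.mul_sum, Finset.sum_filter]
  refine Finset.sum_congr rfl fun z hz => ?_
  rw [← Finset.mul_sum]
  simp_rw [pow_mul]
  have h1 : ((z / z₀) ^ m) ^ p = 1 := by
    rw [← pow_mul, mul_comm m p, div_pow, hs z hz, div_self (pow_ne_zero _ hz₀)]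
  have hiff : z ^ m = z₀ ^ m ↔ (z / z₀) ^ m = 1 := by
    rw [div_pow, div_eq_one_iff_eq (pow_ne_zero _ hz₀)]
  split_ifs with h
  · rw [hiff.1 h]
    simp [mul_comm]
  · rw [geom_sum_eq (fun h' => h (hiff.2 h')), h1]
    simp

theorem sum_mul_div_pow_eq_zero {s : Finset ℂ} {a : ℂ → ℕ} {N u : ℕ} (hN : 0 < N)
    {z₀ : ℂ} (hz₀ : z₀ ≠ 0) (hs : ∀ z ∈ s, z ^ N = z₀ ^ N) (hu : (1 + u).Coprime N)
    (h : ∑ z ∈ s, (a z : ℂ) * z = 0) :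
    ∑ z ∈ s, (a z : ℂ) * z * (z / z₀) ^ u = 0 := by
  have h2 := sum_mul_pow_eq_zero_of_coprime (s := s) (a := a) (y := fun z => z / z₀) hN
    (fun z hz => by rw [div_pow, hs z hz, div_self (pow_ne_zero _ hz₀)]) hu
    (by simp_rw [← mul_div_assoc]; rw [← Finset.sum_div, h, zero_div])
  calc ∑ z ∈ s, (a z : ℂ) * z * (z / z₀) ^ u
      = z₀ * ∑ z ∈ s, (a z : ℂ) * (z / z₀) ^ (1 + u) := by
        rw [Finset.mul_sum]
        refine Finset.sum_congr rfl fun z _ => ?_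
        rw [pow_add, pow_one]
        field_simp
    _ = 0 := by rw [h2, mul_zero]

theorem Nat.Prime.coprime_one_add_mul {p m t : ℕ} (hp : p.Prime) (ht : ¬ p ∣ 1 + m * t) :
    (1 + m * t).Coprime (p * m) :=
  Nat.Coprime.mul_right ((hp.coprime_iff_not_dvd.2 ht).symm) (by simp)

/-- If `p` divides no `1 + m * t`, then the fibre sums of a vanishing sum are zero. -/
theorem sum_filter_pow_eq_zero {s : Finset ℂ} {a : ℂ → ℕ} {p m : ℕ} (hp : p.Prime) (hm : 0 < m)
    {z₀ : ℂ} (hz₀ : z₀ ≠ 0) (hs : ∀ z ∈ s, z ^ (p * m) = z₀ ^ (p * m))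
    (h : ∑ z ∈ s, (a z : ℂ) * z = 0) (ht : ∀ t < p, ¬ p ∣ 1 + m * t) :
    ∑ z ∈ s with z ^ m = z₀ ^ m, (a z : ℂ) * z = 0 := by
  have key := natCast_mul_sum_filter_pow_eq (a := a) hz₀ hs
  rw [Finset.sum_eq_zero fun t h' => sum_mul_div_pow_eq_zero (Nat.mul_pos hp.pos hm) hz₀ hs
    (hp.coprime_one_add_mul (ht t (Finset.mem_range.1 h'))) h] at key
  exact (mul_eq_zero.1 key).resolve_left (by exact_mod_cast hp.ne_zero)

/-- If `p` divides `1 + m * t`, then the fibre sums of a vanishing sum are proportional. -/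
theorem natCast_mul_sum_filter_pow_mul_pow {s : Finset ℂ} {a : ℂ → ℕ} {p m t : ℕ} (hp : p.Prime)
    (hm : 0 < m) {z₀ : ℂ} (hz₀ : z₀ ≠ 0) (hs : ∀ z ∈ s, z ^ (p * m) = z₀ ^ (p * m))
    (h : ∑ z ∈ s, (a z : ℂ) * z = 0) (ht : t < p) (hpt : p ∣ 1 + m * t) :
    (p : ℂ) * (∑ z ∈ s with z ^ m = z₀ ^ m, (a z : ℂ) * z) * z₀ ^ (m * t) =
      ∑ z ∈ s, (a z : ℂ) * z ^ (1 + m * t) := by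
  have hpm : ¬ p ∣ m := fun hd =>
    hp.one_lt.ne' (Nat.dvd_one.1 ((Nat.dvd_add_left (hd.mul_right t)).1 hpt))
  rw [natCast_mul_sum_filter_pow_eq hz₀ hs,
    Finset.sum_eq_single_of_mem t (Finset.mem_range.2 ht), Finset.sum_mul]
  · refine Finset.sum_congr rfl fun z _ => ?_
    rw [div_pow, pow_add]
    field_simp
  · intro t' ht' hne
    refine sum_mul_div_pow_eq_zero (Nat.mul_pos hp.pos hm) hz₀ hs
      (hp.coprime_one_add_mul fun hpt' => hne ?_) h
    rw [Finset.mem_range] at ht'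
    have h3 : m * t' ≡ m * t [MOD p] := by
      have h4 : 1 + m * t' ≡ 1 + m * t [MOD p] :=
        ((Nat.modEq_zero_iff_dvd).2 hpt').trans ((Nat.modEq_zero_iff_dvd).2 hpt).symm
      exact Nat.ModEq.add_left_cancel' 1 h4
    exact (Nat.ModEq.cancel_left_of_coprime
      ((hp.coprime_iff_not_dvd.2 hpm)) h3).eq_of_lt_of_lt ht' ht

/-- The sum of roots of unity encoded by a multiplicity function. -/
def rootSum : (ℂ →₀ ℕ) →+ ℂ :=
  Finsupp.liftAddHom fun z => (AddMonoidHom.mulRight z).comp (Nat.castAddMonoidHom ℂ)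

theorem rootSum_apply (f : ℂ →₀ ℕ) : rootSum f = f.sum fun z c => (c : ℂ) * z := rfl

theorem rootSum_eq_sum (f : ℂ →₀ ℕ) : rootSum f = ∑ z ∈ f.support, (f z : ℂ) * z := rfl

/-- A vanishing, possibly empty, sum of roots of unity. -/
structure IsVanishing (f : ℂ →₀ ℕ) : Prop where
  exists_pow : ∀ z ∈ f.support, ∃ m : ℕ, 0 < m ∧ z ^ m = 1
  sum_eq_zero : rootSum f = 0

/-- A nonempty vanishing sum of roots of unity without proper nonempty vanishing subsums. -/
structure IsMinimalVanishing (f : ℂ →₀ ℕ) : Prop extends IsVanishing f where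
  ne_zero : f ≠ 0
  eq_zero_or_eq : ∀ b ≤ f, rootSum b = 0 → b = 0 ∨ b = f

theorem IsVanishing.ne_zero_of_mem {f : ℂ →₀ ℕ} (hf : IsVanishing f) {z : ℂ}
    (hz : z ∈ f.support) : z ≠ 0 := by
  rintro rfl
  obtain ⟨m, hm, h⟩ := hf.exists_pow 0 hz
  rw [zero_pow hm.ne'] at h
  exact zero_ne_one h

theorem IsVanishing.exists_forall_pow_eq_one {f : ℂ →₀ ℕ} (hf : IsVanishing f) :
    ∃ N : ℕ, 0 < N ∧ ∀ z ∈ f.support, z ^ N = 1 := by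
  choose! m hm hm1 using hf.exists_pow
  refine ⟨∏ z ∈ f.support, m z, Finset.prod_pos hm, fun z hz => ?_⟩
  obtain ⟨k, hk⟩ := Finset.dvd_prod_of_mem m hz
  rw [hk, pow_mul, hm1 z hz, one_pow]

theorem rootSum_filter (f : ℂ →₀ ℕ) (P : ℂ → Prop) [DecidablePred P] :
    rootSum (f.filter P) = ∑ z ∈ f.support with P z, (f z : ℂ) * z := by
  rw [rootSum_eq_sum, Finsupp.support_filter]
  refine Finset.sum_congr rfl fun z hz => ?_
  rw [Finsupp.filter_apply_pos _ _ (Finset.mem_filter.1 hz).2]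

/-- A minimal vanishing sum lies in a single fibre of `z ↦ z ^ m` as soon as the corresponding
fibre sum vanishes. -/
theorem IsMinimalVanishing.pow_eq_of_sum_filter_eq_zero {f : ℂ →₀ ℕ} (hf : IsMinimalVanishing f)
    {m : ℕ} {z₀ : ℂ} (hz₀ : z₀ ∈ f.support)
    (h : ∑ z ∈ f.support with z ^ m = z₀ ^ m, (f z : ℂ) * z = 0) :
    ∀ z ∈ f.support, z ^ m = z₀ ^ m := by
  classical
  rw [← rootSum_filter] at h
  have hle : f.filter (fun z => z ^ m = z₀ ^ m) ≤ f := fun z => by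
    rw [Finsupp.filter_apply]
    split_ifs <;> simp
  rcases hf.eq_zero_or_eq _ hle h with h0 | h1
  · have := DFunLike.congr_fun h0 z₀
    rw [Finsupp.filter_apply_pos (fun z => z ^ m = z₀ ^ m) f rfl] at this
    exact absurd this (Finsupp.mem_support_iff.1 hz₀)
  · intro z hz
    rw [← h1, Finsupp.support_filter] at hz
    exact (Finset.mem_filter.1 hz).2

theorem card_support_le_degree (f : ℂ →₀ ℕ) : f.support.card ≤ f.degree := by
  rw [Finsupp.degree_apply, Finset.card_eq_sum_ones]
  exact Finset.sum_le_sum fun z hz => Nat.one_le_iff_ne_zero.2 (Finsupp.mem_support_iff.1 hz)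

/-- If every fibre of `z ↦ z ^ m` meets the finset `s`, then `s` has at least `p` elements. -/
theorem le_card_of_forall_exists_pow_eq {s : Finset ℂ} {p m : ℕ} (hp : 0 < p) (hm : 0 < m)
    {D : ℂ} (hD : D ≠ 0) (h : ∀ z₀ : ℂ, z₀ ^ (p * m) = D → ∃ z ∈ s, z ^ m = z₀ ^ m) :
    p ≤ s.card := by
  classical
  have hξ := Complex.isPrimitiveRoot_exp p hp.ne'
  have hcard : (Polynomial.nthRoots p D).toFinset.card = p := by
    rw [Multiset.toFinset_card_of_nodup (hξ.nthRoots_nodup hD), hξ.card_nthRoots,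
      if_pos (IsAlgClosed.exists_pow_nat_eq D hp)]
  calc p = (Polynomial.nthRoots p D).toFinset.card := hcard.symm
    _ ≤ (s.image (· ^ m)).card := by
      refine Finset.card_le_card fun d hd => ?_
      rw [Multiset.mem_toFinset, Polynomial.mem_nthRoots hp] at hd
      obtain ⟨z₀, rfl⟩ := IsAlgClosed.exists_pow_nat_eq d hm
      obtain ⟨z, hz, hz'⟩ := h z₀ (by rw [mul_comm, pow_mul, hd])
      exact Finset.mem_image.2 ⟨z, hz, hz'⟩
    _ ≤ s.card := Finset.card_image_le

/-- **Mann's theorem** in weight at most six: a minimal vanishing sum is, up to rotation, a sum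
of roots of unity of order dividing `30`. -/
theorem IsMinimalVanishing.pow_thirty_eq {f : ℂ →₀ ℕ} (hf : IsMinimalVanishing f)
    (hdeg : f.degree ≤ 6) : ∀ z ∈ f.support, ∀ w ∈ f.support, z ^ 30 = w ^ 30 := by
  classical
  have hex : ∃ N : ℕ, 0 < N ∧ ∀ z ∈ f.support, ∀ w ∈ f.support, z ^ N = w ^ N := by
    obtain ⟨N, hN, h⟩ := hf.exists_forall_pow_eq_one
    exact ⟨N, hN, fun z hz w hw => by rw [h z hz, h w hw]⟩
  obtain ⟨c, hc⟩ := Finsupp.support_nonempty_iff.2 hf.ne_zero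
  have hc0 := hf.ne_zero_of_mem hc
  set N := Nat.find hex with hNdef
  obtain ⟨hN, hpow⟩ := Nat.find_spec hex
  rw [← hNdef] at hN hpow
  have hprime : ∀ p m : ℕ, p.Prime → N = p * m → ¬ p ∣ m ∧ p ≤ 6 := by
    intro p m hp hNpm
    have hm : 0 < m := Nat.pos_of_ne_zero fun h => by simp [hNpm, h] at hN
    have hmN : m < N := by
      rw [hNpm]
      exact lt_mul_left hm hp.one_lt
    have hnot := Nat.find_min hex (hNdef ▸ hmN)
    have hC : ∀ z₀ ∈ f.support, ∑ z ∈ f.support with z ^ m = z₀ ^ m, (f z : ℂ) * z ≠ 0 := by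
      intro z₀ hz₀ h
      have h' := hf.pow_eq_of_sum_filter_eq_zero hz₀ h
      exact hnot ⟨hm, fun z hz w hw => by rw [h' z hz, h' w hw]⟩
    have hs : ∀ z₀ : ℂ, z₀ ^ (p * m) = c ^ (p * m) →
        ∀ z ∈ f.support, z ^ (p * m) = z₀ ^ (p * m) := fun z₀ h z hz => by
      rw [h, ← hNpm, hpow z hz c hc]
    have hsum := hf.sum_eq_zero
    rw [rootSum_eq_sum] at hsum
    by_cases ht : ∃ t < p, p ∣ 1 + m * t
    · obtain ⟨t, ht, hpt⟩ := ht
      refine ⟨fun hd => hp.one_lt.ne'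
        (Nat.dvd_one.1 ((Nat.dvd_add_left (hd.mul_right t)).1 hpt)), ?_⟩
      have hG := natCast_mul_sum_filter_pow_mul_pow hp hm hc0 (hs c rfl) hsum ht hpt
      refine (le_card_of_forall_exists_pow_eq hp.pos hm (pow_ne_zero (p * m) hc0)
        fun z₀ hz₀ => ?_).trans ((card_support_le_degree f).trans hdeg)
      have hz₀0 : z₀ ≠ 0 := by
        rintro rfl
        rw [zero_pow (Nat.mul_pos hp.pos hm).ne'] at hz₀
        exact pow_ne_zero _ hc0 hz₀.symm
      by_contra! hno
      rw [← natCast_mul_sum_filter_pow_mul_pow hp hm hz₀0 (hs z₀ hz₀) hsum ht hpt,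
        Finset.filter_eq_empty_iff.2 (fun z hz => hno z hz), Finset.sum_empty, mul_zero,
        zero_mul] at hG
      have hp0 : (p : ℂ) ≠ 0 := by exact_mod_cast hp.ne_zero
      exact mul_ne_zero (mul_ne_zero hp0 (hC c hc)) (pow_ne_zero _ hc0) hG
    · push Not at ht
      exact absurd (sum_filter_pow_eq_zero hp hm hc0 (hs c rfl) hsum ht) (hC c hc)
  have hsq : Squarefree N := Nat.squarefree_iff_prime_squarefree.2 fun p hp ⟨k, hk⟩ =>
    (hprime p (p * k) hp (by rw [hk, mul_assoc])).1 (dvd_mul_right p k)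
  have hsub : N.primeFactors ⊆ {2, 3, 5} := fun p hp => by
    have hpp := Nat.prime_of_mem_primeFactors hp
    obtain ⟨m, hm⟩ := Nat.dvd_of_mem_primeFactors hp
    have hp6 := (hprime p m hpp hm).2
    interval_cases p <;> first | (simp; done) | exact absurd hpp (by norm_num)
  have hdvd : N ∣ 30 := by
    have h := Finset.prod_dvd_prod_of_subset _ _ (fun p : ℕ => p) hsub
    rwa [Nat.prod_primeFactors_of_squarefree hsq] at h
  obtain ⟨k, hk⟩ := hdvd
  intro z hz w hw
  rw [hk, pow_mul, pow_mul, hpow z hz w hw]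

/-- The `60`-th roots of unity `exp (2 * π * I * k / 60)`. -/
def root60 : AddChar (ZMod 60) ℂ := ZMod.stdAddChar

theorem root60_injective : Function.Injective root60 := ZMod.injective_stdAddChar

theorem root60_ne_zero (k : ZMod 60) : root60 k ≠ 0 := AddChar.val_isUnit root60 k |>.ne_zero

theorem root60_pow (k : ZMod 60) (n : ℕ) : root60 k ^ n = root60 (n * k) := by
  rw [← AddChar.map_nsmul_eq_pow, nsmul_eq_mul]

theorem root60_thirty : root60 30 = -1 := by
  have h : root60 30 ^ 2 = 1 := by
    rw [root60_pow, ← AddChar.map_zero_eq_one root60]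
    rfl
  refine (sq_eq_one_iff.1 h).resolve_left fun h1 => ?_
  rw [← AddChar.map_zero_eq_one root60] at h1
  exact absurd (root60_injective h1) (by decide)

theorem root60_twenty : root60 20 = root60 10 - 1 := by
  have h3 : root60 10 ^ 3 = -1 := by
    rw [root60_pow, ← root60_thirty]
    rfl
  have h2 : root60 10 ^ 2 = root60 20 := by
    rw [root60_pow]
    rfl
  have hne : root60 10 + 1 ≠ 0 := fun h => by
    have h1 : root60 10 = root60 30 := by rw [root60_thirty]; linear_combination h
    exact absurd (root60_injective h1) (by decide)
  rw [← h2]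
  refine mul_left_cancel₀ hne ?_
  linear_combination h3

theorem root60_ten_im_ne_zero : (root60 10).im ≠ 0 := fun h => by
  have h2 : root60 10 ^ 2 = root60 10 - 1 := by
    rw [root60_pow, ← root60_twenty]
    rfl
  have hre := congrArg Complex.re h2
  simp only [pow_two, Complex.mul_re, h, Complex.sub_re, Complex.one_re] at hre
  nlinarith [sq_nonneg ((root60 10).re - 1)]

theorem root60_fin (l : Fin 6) : root60 (10 * (l.val : ZMod 60)) =
    ![1, root60 10, root60 10 - 1, -1, -root60 10, 1 - root60 10] l := by
  have h40 : root60 40 = root60 30 * root60 10 := by rw [← AddChar.map_add_eq_mul]; rfl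
  have h50 : root60 50 = root60 30 * root60 20 := by rw [← AddChar.map_add_eq_mul]; rfl
  fin_cases l
  · exact AddChar.map_zero_eq_one _
  · rfl
  · exact root60_twenty
  · exact root60_thirty
  · exact h40.trans (by rw [root60_thirty]; simp)
  · exact h50.trans (by rw [root60_thirty, root60_twenty]; simp)

/-- The coordinates of a sum of sixth roots of unity, with multiplicities `v`, in the basis
`1, exp (2 * π * I / 6)` of the Eisenstein integers. -/
def hexCoord (v : Fin 6 → ℕ) : ℤ × ℤ :=
  ((v 0 : ℤ) - v 2 - v 3 + v 5, (v 1 : ℤ) + v 2 - v 4 - v 5)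

theorem sum_mul_root60 (v : Fin 6 → ℕ) : ∑ l, (v l : ℂ) * root60 (10 * (l.val : ZMod 60)) =
    (hexCoord v).1 + (hexCoord v).2 * root60 10 := by
  simp only [root60_fin, Fin.sum_univ_six, hexCoord]
  simp
  ring

theorem hexCoord_eq_of_sum_eq {v u : Fin 6 → ℕ}
    (h : ∑ l, (v l : ℂ) * root60 (10 * (l.val : ZMod 60)) =
      ∑ l, (u l : ℂ) * root60 (10 * (l.val : ZMod 60))) : hexCoord v = hexCoord u := by
  rw [sum_mul_root60, sum_mul_root60] at h
  have h2 : (hexCoord v).2 = (hexCoord u).2 := by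
    have := congrArg Complex.im h
    simpa [root60_ten_im_ne_zero] using this
  have h1 : (hexCoord v).1 = (hexCoord u).1 := by
    rw [h2] at h
    exact_mod_cast add_right_cancel h
  exact Prod.ext h1 h2

theorem exists_of_hexCoord_eq_zero {v : Fin 6 → ℕ} (h : hexCoord v = 0) (hv : 1 ≤ v 0) :
    1 ≤ v 3 ∨ 1 ≤ v 2 ∧ 1 ≤ v 4 := by
  simp only [hexCoord, Prod.mk_eq_zero] at h
  omega

theorem exists_of_sum_eq_one {v : Fin 6 → ℕ} (hv : ∑ l, v l = 1) :
    ∃ l, ∀ u : Fin 6 → ℕ, hexCoord u = hexCoord v →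
      (∑ l, u l = 1 → 1 ≤ u l) ∧ (∑ l, u l = 2 → 1 ≤ u (l + 1) ∧ 1 ≤ u (l + 5)) := by
  have hl : ∃ l, v l = 1 ∧ ∀ k ≠ l, v k = 0 := by
    obtain ⟨l, -, hl⟩ := Finset.exists_ne_zero_of_sum_ne_zero (hv.trans_ne one_ne_zero)
    have h := Finset.add_sum_erase Finset.univ v (Finset.mem_univ l)
    refine ⟨l, by omega, fun k hk => ?_⟩
    have := Finset.single_le_sum (f := v) (fun _ _ => Nat.zero_le _)
      (Finset.mem_erase.2 ⟨hk, Finset.mem_univ k⟩)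
    omega
  obtain ⟨l, h1, h0⟩ := hl
  refine ⟨l, fun u hu => ?_⟩
  simp only [hexCoord, Prod.mk.injEq] at hu
  simp only [Fin.sum_univ_six] at hv ⊢
  have hl : l = 0 ∨ l = 1 ∨ l = 2 ∨ l = 3 ∨ l = 4 ∨ l = 5 :=
    (by decide : ∀ l : Fin 6, l = 0 ∨ l = 1 ∨ l = 2 ∨ l = 3 ∨ l = 4 ∨ l = 5) l
  have h0' := h0 0
  have h1' := h0 1
  have h2' := h0 2
  have h3' := h0 3
  have h4' := h0 4
  have h5' := h0 5
  rcases hl with rfl | rfl | rfl | rfl | rfl | rfl <;>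
    simp [Fin.reduceAdd] at h0' h1' h2' h3' h4' h5' ⊢ <;> omega

/-- The multiplicity function of the sum of the `η * root60 k` for `k ∈ E`. -/
def rotatedSum (η : ℂ) (E : Finset (ZMod 60)) : ℂ →₀ ℕ := ∑ k ∈ E, Finsupp.single (η * root60 k) 1

theorem rotatedSum_apply {η : ℂ} (hη : η ≠ 0) (E : Finset (ZMod 60)) (k : ZMod 60) :
    rotatedSum η E (η * root60 k) = if k ∈ E then 1 else 0 := by
  classical
  simp [rotatedSum, Finsupp.finsetSum_apply, Finsupp.single_apply, hη, root60_injective.eq_iff]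

theorem rotatedSum_ne_zero_iff {η : ℂ} (E : Finset (ZMod 60)) (z : ℂ) :
    rotatedSum η E z ≠ 0 ↔ ∃ k ∈ E, η * root60 k = z := by
  classical
  simp [rotatedSum, Finsupp.finsetSum_apply, Finsupp.single_apply]

theorem rotatedSum_le {η : ℂ} (hη : η ≠ 0) {E : Finset (ZMod 60)} {f : ℂ →₀ ℕ}
    (h : ∀ k ∈ E, 1 ≤ f (η * root60 k)) : rotatedSum η E ≤ f := fun z => by
  by_cases hz : rotatedSum η E z = 0
  · rw [hz]
    exact Nat.zero_le _
  · obtain ⟨k, hk, rfl⟩ := (rotatedSum_ne_zero_iff E z).1 hz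
    rw [rotatedSum_apply hη, if_pos hk]
    exact h k hk

theorem degree_rotatedSum (η : ℂ) (E : Finset (ZMod 60)) : (rotatedSum η E).degree = E.card := by
  simp [rotatedSum, map_sum]

theorem rootSum_rotatedSum (η : ℂ) (E : Finset (ZMod 60)) :
    rootSum (rotatedSum η E) = η * ∑ k ∈ E, root60 k := by
  simp [rotatedSum, map_sum, rootSum_apply, Finset.mul_sum]

/-- The exponents of the vanishing sums of two, three and five equidistributed roots of unity. -/
def regularExponents : List (Finset (ZMod 60)) := [{0, 30}, {0, 20, 40}, {0, 12, 24, 36, 48}]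

/-- The exponents of the vanishing sum obtained by subtracting a sum of three equidistributed
roots of unity from a sum of five. -/
def mixedExponents : Finset (ZMod 60) := {10, 50, 12, 24, 36, 48}

theorem sum_root60_eq_zero_of_add_mem {E : Finset (ZMod 60)} {d : ZMod 60} (hd : d ≠ 0)
    (hE : E.image (· + d) = E) : ∑ k ∈ E, root60 k = 0 := by
  have h : ∑ k ∈ E, root60 k = (∑ k ∈ E, root60 k) * root60 d := by
    conv_lhs => rw [← hE]
    rw [Finset.sum_image fun a _ b _ hab => add_right_cancel hab, Finset.sum_mul]
    exact Finset.sum_congr rfl fun k _ => AddChar.map_add_eq_mul _ _ _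
  have hne : 1 - root60 d ≠ 0 := fun h1 => by
    have : root60 0 = root60 d := by rw [AddChar.map_zero_eq_one]; linear_combination h1
    exact hd (root60_injective this).symm
  refine (mul_eq_zero.1 ?_).resolve_right hne
  linear_combination h

theorem sum_root60_regularExponents : ∀ E ∈ regularExponents, ∑ k ∈ E, root60 k = 0 := by
  intro E hE
  simp only [regularExponents, List.mem_cons, List.not_mem_nil, or_false] at hE
  rcases hE with rfl | rfl | rfl
  · exact sum_root60_eq_zero_of_add_mem (d := 30) (by decide) (by decide)
  · exact sum_root60_eq_zero_of_add_mem (d := 20) (by decide) (by decide)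
  · exact sum_root60_eq_zero_of_add_mem (d := 12) (by decide) (by decide)

theorem sum_root60_mixedExponents : ∑ k ∈ mixedExponents, root60 k = 0 := by
  have h5 := sum_root60_regularExponents {0, 12, 24, 36, 48} (by simp [regularExponents])
  have h50 : root60 50 = 1 - root60 10 := root60_fin 5
  rw [Finset.sum_insert (by decide), AddChar.map_zero_eq_one] at h5
  rw [mixedExponents, Finset.sum_insert (by decide), Finset.sum_insert (by decide), h50]
  linear_combination h5

/-- The multiplicities in `f` of the products of `z` with the sixth roots of unity. -/
def hexRow (f : ℂ →₀ ℕ) (z : ℂ) (l : Fin 6) : ℕ := f (z * root60 (10 * (l.val : ZMod 60)))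

theorem isPrimitiveRoot_root60_ten : IsPrimitiveRoot (root60 10) 6 := by
  refine ⟨?_, fun l hl => ?_⟩
  · rw [root60_pow, ← AddChar.map_zero_eq_one root60]
    rfl
  · rw [root60_pow, ← AddChar.map_zero_eq_one root60] at hl
    have h := root60_injective hl
    have h' : ((l * 10 : ℕ) : ZMod 60) = 0 := by exact_mod_cast h
    rw [ZMod.natCast_eq_zero_iff] at h'
    omega

theorem sum_filter_pow_six_eq (f : ℂ →₀ ℕ) {z₀ : ℂ} (hz₀ : z₀ ≠ 0) :
    ∑ z ∈ f.support with z ^ 6 = z₀ ^ 6, (f z : ℂ) * z =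
      z₀ * ∑ l, (hexRow f z₀ l : ℂ) * root60 (10 * (l.val : ZMod 60)) := by
  classical
  have hinj : Function.Injective fun l : Fin 6 => z₀ * root60 (10 * (l.val : ZMod 60)) :=
    fun l k h => by
      have h' := root60_injective (mul_left_cancel₀ hz₀ h)
      clear h
      revert l k
      decide
  have hr : z₀ * ∑ l, (hexRow f z₀ l : ℂ) * root60 (10 * (l.val : ZMod 60)) =
      ∑ z ∈ Finset.univ.image fun l : Fin 6 => z₀ * root60 (10 * (l.val : ZMod 60)),
        (f z : ℂ) * z := by
    rw [Finset.sum_image hinj.injOn, Finset.mul_sum]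
    refine Finset.sum_congr rfl fun l _ => ?_
    rw [hexRow]
    ring
  rw [hr]
  have hmem : ∀ z : ℂ, z ^ 6 = z₀ ^ 6 ↔
      z ∈ Finset.univ.image fun l : Fin 6 => z₀ * root60 (10 * (l.val : ZMod 60)) := by
    intro z
    rw [Finset.mem_image]
    constructor
    · intro h
      obtain ⟨l, hl, hl'⟩ := isPrimitiveRoot_root60_ten.eq_pow_of_pow_eq_one (ξ := z / z₀)
        (by rw [div_pow, h, div_self (pow_ne_zero _ hz₀)])
      refine ⟨⟨l, hl⟩, Finset.mem_univ _, ?_⟩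
      rw [mul_comm (10 : ZMod 60), ← root60_pow, hl', mul_div_cancel₀ _ hz₀]
    · rintro ⟨l, -, rfl⟩
      rw [mul_pow, mul_comm (10 : ZMod 60), ← root60_pow, ← pow_mul, mul_comm l.val, pow_mul,
        isPrimitiveRoot_root60_ten.pow_eq_one, one_pow, mul_one]
  refine Finset.sum_subset (fun z hz => (hmem z).1 (Finset.mem_filter.1 hz).2) fun z hz hz' => ?_
  have h0 : f z = 0 := by
    by_contra h0
    exact hz' (Finset.mem_filter.2 ⟨Finsupp.mem_support_iff.2 h0, (hmem z).2 hz⟩)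
  rw [h0]
  simp

theorem hexCoord_hexRow_eq {f : ℂ →₀ ℕ} (hf : rootSum f = 0) {c : ℂ} (hc : c ≠ 0)
    (h30 : ∀ z ∈ f.support, z ^ 30 = c ^ 30) (j : ZMod 60) :
    hexCoord (hexRow f (c * root60 (12 * j))) = hexCoord (hexRow f c) := by
  have hG : ∀ z₀ : ℂ, z₀ ≠ 0 → z₀ ^ 30 = c ^ 30 →
      z₀ ^ 25 * ∑ l, (hexRow f z₀ l : ℂ) * root60 (10 * (l.val : ZMod 60)) =
        (∑ z ∈ f.support, (f z : ℂ) * z ^ 25) / 5 := fun z₀ hz₀ h => by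
    have h1 := natCast_mul_sum_filter_pow_mul_pow (s := f.support) (a := f) (m := 6) (t := 4)
      Nat.prime_five (by norm_num) hz₀ (fun z hz => (h30 z hz).trans h.symm) hf (by norm_num)
      (by norm_num)
    rw [sum_filter_pow_six_eq f hz₀] at h1
    norm_num at h1
    rw [← h1]
    ring
  have hne : c * root60 (12 * j) ≠ 0 := mul_ne_zero hc (root60_ne_zero _)
  have hpow : ∀ n : ℕ, (n : ZMod 60) * 12 = 0 → (c * root60 (12 * j)) ^ n = c ^ n := fun n hn => by
    rw [mul_pow, root60_pow, ← mul_assoc, hn, zero_mul, AddChar.map_zero_eq_one, mul_one]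
  have h1 := (hG _ hne (hpow 30 rfl)).trans (hG c hc rfl).symm
  rw [hpow 25 rfl] at h1
  exact hexCoord_eq_of_sum_eq (mul_left_cancel₀ (pow_ne_zero _ hc) h1)

theorem sum_hexRow_le_degree (f : ℂ →₀ ℕ) {c : ℂ} (hc : c ≠ 0) :
    ∑ i : Fin 5, ∑ l, hexRow f (c * root60 (12 * (i.val : ZMod 60))) l ≤ f.degree := by
  classical
  have hinj : Function.Injective fun x : Fin 5 × Fin 6 =>
      c * root60 (12 * (x.1.val : ZMod 60)) * root60 (10 * (x.2.val : ZMod 60)) := fun x y h => by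
    simp only [mul_assoc, ← AddChar.map_add_eq_mul] at h
    have h' := root60_injective (mul_left_cancel₀ hc h)
    clear h
    revert x y
    decide +kernel
  rw [← Fintype.sum_prod_type', Finsupp.degree_apply]
  simp only [hexRow]
  rw [← Finset.sum_image (f := fun z => f z) hinj.injOn]
  exact Finset.sum_le_sum_of_ne_zero fun z _ hz => Finsupp.mem_support_iff.2 hz

/-- A vanishing sum of at most six roots of unity contains one of the four basic ones. -/
theorem IsMinimalVanishing.eq_rotatedSum {f : ℂ →₀ ℕ} (hf : IsMinimalVanishing f)
    (hdeg : f.degree ≤ 6) :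
    ∃ η ≠ 0, (∃ E ∈ regularExponents, f = rotatedSum η E) ∨ f = rotatedSum η mixedExponents := by
  classical
  have heq : ∀ {η : ℂ} {E : Finset (ZMod 60)}, η ≠ 0 → E.Nonempty → ∑ k ∈ E, root60 k = 0 →
      (∀ k ∈ E, 1 ≤ f (η * root60 k)) → f = rotatedSum η E := by
    intro η E hη hE hsum h
    refine ((hf.eq_zero_or_eq _ (rotatedSum_le hη h)
      (by rw [rootSum_rotatedSum, hsum, mul_zero])).resolve_left fun h0 => ?_).symm
    have := degree_rotatedSum η E
    rw [h0, map_zero] at this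
    exact hE.ne_empty (Finset.card_eq_zero.1 this.symm)
  have hreg : ∀ {η : ℂ} {E : Finset (ZMod 60)}, η ≠ 0 → E ∈ regularExponents →
      (∀ k ∈ E, 1 ≤ f (η * root60 k)) → ∃ η ≠ 0, (∃ E ∈ regularExponents, f = rotatedSum η E) ∨
        f = rotatedSum η mixedExponents := by
    intro η E hη hE h
    have hne : E.Nonempty := by
      simp only [regularExponents, List.mem_cons, List.not_mem_nil, or_false] at hE
      rcases hE with rfl | rfl | rfl <;> exact Finset.insert_nonempty _ _
    exact ⟨η, hη, .inl ⟨E, hE, heq hη hne (sum_root60_regularExponents E hE) h⟩⟩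
  obtain ⟨c, hcs⟩ := Finsupp.support_nonempty_iff.2 hf.ne_zero
  have hc := hf.ne_zero_of_mem hcs
  have hcj : ∀ j : ZMod 60, c * root60 j ≠ 0 := fun j => mul_ne_zero hc (root60_ne_zero _)
  have hcoord := hexCoord_hexRow_eq hf.sum_eq_zero hc fun z hz => hf.pow_thirty_eq hdeg z hz c hcs
  set v : ZMod 60 → Fin 6 → ℕ := fun j => hexRow f (c * root60 (12 * j)) with hv
  have hcoord' : ∀ i j, hexCoord (v i) = hexCoord (v j) := fun i j =>
    (hcoord i).trans (hcoord j).symm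
  have hdegv : ∀ j, ∑ l, v j l + ∑ l, v (j + 1) l + ∑ l, v (j + 2) l + ∑ l, v (j + 3) l +
      ∑ l, v (j + 4) l ≤ 6 := fun j => by
    have h := (sum_hexRow_le_degree f (hcj (12 * j))).trans hdeg
    rw [Fin.sum_univ_five] at h
    simp only [mul_assoc, ← AddChar.map_add_eq_mul, ← mul_add] at h
    simpa [hv] using h
  have hval : ∀ j l, v j l = f (c * root60 (12 * j + 10 * (l.val : ZMod 60))) := fun j l => by
    simp only [hv, hexRow, mul_assoc, ← AddChar.map_add_eq_mul]
  by_cases hz : ∃ j, ∑ l, v j l = 0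
  · obtain ⟨j, hj⟩ := hz
    have h0 : hexCoord (v 0) = 0 := by
      rw [hcoord' 0 j, show v j = 0 from funext fun l => Finset.sum_eq_zero_iff.1 hj l
        (Finset.mem_univ l)]
      rfl
    have h00 : 1 ≤ f (c * root60 0) := by
      rw [AddChar.map_zero_eq_one, mul_one]
      exact Nat.one_le_iff_ne_zero.2 (Finsupp.mem_support_iff.1 hcs)
    rcases exists_of_hexCoord_eq_zero h0 (by rw [hval]; exact h00) with h3 | ⟨h2, h4⟩
    · rw [hval] at h3
      refine hreg hc (E := {0, 30}) (by simp [regularExponents]) ?_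
      simp only [Finset.mem_insert, Finset.mem_singleton, forall_eq_or_imp, forall_eq]
      exact ⟨h00, h3⟩
    · rw [hval] at h2 h4
      refine hreg hc (E := {0, 20, 40}) (by simp [regularExponents]) ?_
      simp only [Finset.mem_insert, Finset.mem_singleton, forall_eq_or_imp, forall_eq]
      exact ⟨h00, h2, h4⟩
  · push Not at hz
    have hpos : ∀ j, 1 ≤ ∑ l, v j l := fun j => Nat.one_le_iff_ne_zero.2 (hz j)
    have hrot : ∀ (j i : ZMod 60) (l : Fin 6), v (j + i) l =
        f (c * root60 (12 * j + 10 * (l.val : ZMod 60)) * root60 (12 * i)) := fun j i l => by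
      rw [hval, mul_assoc, ← AddChar.map_add_eq_mul]
      congr 3
      ring
    by_cases h2 : ∃ j, ∑ l, v j l = 2
    · obtain ⟨j, hj⟩ := h2
      have h := hdegv j
      have p1 := hpos (j + 1)
      have p2 := hpos (j + 2)
      have p3 := hpos (j + 3)
      have p4 := hpos (j + 4)
      obtain ⟨l, hl⟩ := exists_of_sum_eq_one (v := v (j + 1)) (by omega)
      have q0 := (hl _ (hcoord' j (j + 1))).2 hj
      have q1 := (hl _ (hcoord' (j + 1) (j + 1))).1 (by omega)
      have q2 := (hl _ (hcoord' (j + 2) (j + 1))).1 (by omega)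
      have q3 := (hl _ (hcoord' (j + 3) (j + 1))).1 (by omega)
      have q4 := (hl _ (hcoord' (j + 4) (j + 1))).1 (by omega)
      refine ⟨_, hcj (12 * j + 10 * (l.val : ZMod 60)), .inr (heq (hcj _)
        (Finset.insert_nonempty _ _) sum_root60_mixedExponents ?_)⟩
      have hl1 : ∀ (d : Fin 6) (e : ZMod 60), (10 * ((l + d).val : ZMod 60)) = 10 * l.val + e →
          v j (l + d) = f (c * root60 (12 * j + 10 * (l.val : ZMod 60)) * root60 e) :=
        fun d e h => by
          rw [hval, mul_assoc, ← AddChar.map_add_eq_mul, h, add_assoc]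
      rw [hl1 1 10 (by clear * -; revert l; decide), hl1 5 50 (by clear * -; revert l; decide)]
        at q0
      rw [hrot] at q1 q2 q3 q4
      simp only [mixedExponents, Finset.mem_insert, Finset.mem_singleton, forall_eq_or_imp,
        forall_eq]
      exact ⟨q0.1, q0.2, q1, q2, q3, q4⟩
    · push Not at h2
      have h1 : ∀ j, ∑ l, v j l = 1 := fun j => by
        have h := hdegv j
        have p0 := hpos j
        have p1 := hpos (j + 1)
        have p2 := hpos (j + 2)
        have p3 := hpos (j + 3)
        have p4 := hpos (j + 4)
        have := h2 j
        omega
      obtain ⟨l, hl⟩ := exists_of_sum_eq_one (h1 0)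
      have q : ∀ i, 1 ≤ f (c * root60 (12 * 0 + 10 * (l.val : ZMod 60)) * root60 (12 * i)) :=
        fun i => by
          rw [← hrot]
          exact (hl _ (hcoord' _ _)).1 (h1 _)
      refine hreg (hcj (12 * 0 + 10 * (l.val : ZMod 60))) (E := {0, 12, 24, 36, 48}) (by simp [regularExponents]) ?_
      simp only [Finset.mem_insert, Finset.mem_singleton, forall_eq_or_imp, forall_eq]
      exact ⟨q 0, q 1, q 2, q 3, q 4⟩

theorem mapDomain_inv_apply (f : ℂ →₀ ℕ) (z : ℂ) : f.mapDomain Inv.inv z = f z⁻¹ :=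
  Finsupp.mapDomain_equiv_apply (f := Equiv.inv ℂ) f z

theorem mapDomain_inv_mapDomain_inv (f : ℂ →₀ ℕ) :
    (f.mapDomain (Inv.inv : ℂ → ℂ)).mapDomain Inv.inv = f := by
  ext z
  simp [mapDomain_inv_apply]

theorem mapDomain_inv_mono {f g : ℂ →₀ ℕ} (h : f ≤ g) :
    f.mapDomain (Inv.inv : ℂ → ℂ) ≤ g.mapDomain Inv.inv := fun z => by
  rw [mapDomain_inv_apply, mapDomain_inv_apply]
  exact h _

theorem exists_pow_of_le {f g : ℂ →₀ ℕ} (hg : ∀ z ∈ g.support, ∃ m : ℕ, 0 < m ∧ z ^ m = 1)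
    (h : f ≤ g) : ∀ z ∈ f.support, ∃ m : ℕ, 0 < m ∧ z ^ m = 1 :=
  fun z hz => hg z (Finsupp.support_mono h hz)

theorem exists_pow_mapDomain_inv {f : ℂ →₀ ℕ}
    (hf : ∀ z ∈ f.support, ∃ m : ℕ, 0 < m ∧ z ^ m = 1) :
    ∀ z ∈ (f.mapDomain (Inv.inv : ℂ → ℂ)).support, ∃ m : ℕ, 0 < m ∧ z ^ m = 1 := fun z hz => by
  rw [Finsupp.mem_support_iff, mapDomain_inv_apply, ← Finsupp.mem_support_iff] at hz
  obtain ⟨m, hm, h⟩ := hf _ hz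
  exact ⟨m, hm, by rwa [inv_pow, inv_eq_one] at h⟩

theorem rootSum_mapDomain_inv {f : ℂ →₀ ℕ}
    (hf : ∀ z ∈ f.support, ∃ m : ℕ, 0 < m ∧ z ^ m = 1) :
    rootSum (f.mapDomain Inv.inv) = starRingEnd ℂ (rootSum f) := by
  rw [rootSum_apply, Finsupp.sum_mapDomain_index (by simp) (by intros; push_cast; ring),
    rootSum_eq_sum, map_sum]
  refine Finset.sum_congr rfl fun z hz => ?_
  obtain ⟨m, hm, h⟩ := hf z hz
  dsimp only
  rw [map_mul, map_natCast, Complex.inv_eq_conj (Complex.norm_eq_one_of_pow_eq_one h hm.ne')]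

theorem IsMinimalVanishing.mapDomain_inv {f : ℂ →₀ ℕ} (hf : IsMinimalVanishing f) :
    IsMinimalVanishing (f.mapDomain Inv.inv) where
  exists_pow := exists_pow_mapDomain_inv hf.exists_pow
  sum_eq_zero := by rw [rootSum_mapDomain_inv hf.exists_pow, hf.sum_eq_zero, map_zero]
  ne_zero h := hf.ne_zero (by rw [← mapDomain_inv_mapDomain_inv f, h, Finsupp.mapDomain_zero])
  eq_zero_or_eq b hb hb0 := by
    have hle := mapDomain_inv_mono hb
    rw [mapDomain_inv_mapDomain_inv] at hle
    have hroot := exists_pow_of_le (exists_pow_mapDomain_inv hf.exists_pow) hb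
    rcases hf.eq_zero_or_eq _ hle (by rw [rootSum_mapDomain_inv hroot, hb0, map_zero]) with h | h
    · left
      rw [← mapDomain_inv_mapDomain_inv b, h, Finsupp.mapDomain_zero]
    · right
      rw [← mapDomain_inv_mapDomain_inv b, h]

theorem rootSum_sub {f g : ℂ →₀ ℕ} (h : g ≤ f) : rootSum (f - g) = rootSum f - rootSum g := by
  rw [eq_sub_iff_add_eq, ← map_add, tsub_add_cancel_of_le h]

theorem IsVanishing.sub {f g : ℂ →₀ ℕ} (hf : IsVanishing f) (hle : g ≤ f) (hg : rootSum g = 0) :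
    IsVanishing (f - g) where
  exists_pow := exists_pow_of_le hf.exists_pow tsub_le_self
  sum_eq_zero := by rw [rootSum_sub hle, hf.sum_eq_zero, hg, sub_zero]

theorem Finsupp.degree_sub_add {f g : ℂ →₀ ℕ} (h : g ≤ f) :
    (f - g).degree + g.degree = f.degree := by
  rw [← map_add, tsub_add_cancel_of_le h]

theorem Finsupp.eq_of_le_of_degree_le {f g : ℂ →₀ ℕ} (h : g ≤ f) (hd : f.degree ≤ g.degree) :
    g = f := by
  have h1 := Finsupp.degree_sub_add h
  have h2 : (f - g).degree = 0 := by omega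
  exact le_antisymm h (tsub_eq_zero_iff_le.1 ((Finsupp.degree_eq_zero_iff _).1 h2))

theorem mapDomain_inv_eq_self {f : ℂ →₀ ℕ} (h : ∀ z, f z ≠ 0 → f z⁻¹ = f z) :
    f.mapDomain Inv.inv = f := by
  ext z
  rw [mapDomain_inv_apply]
  by_cases hz : f z = 0
  · by_contra hne
    have h' := h z⁻¹ (by rwa [hz] at hne)
    rw [inv_inv] at h'
    exact hne h'.symm
  · exact h z hz

theorem add_mapDomain_inv_le {f T : ℂ →₀ ℕ} (hstable : f.mapDomain Inv.inv = f) (hT : T ≤ f)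
    (h : ∀ z, T z ≠ 0 → T z⁻¹ = 0) : T + T.mapDomain Inv.inv ≤ f := fun z => by
  rw [Finsupp.add_apply, mapDomain_inv_apply]
  by_cases hz : T z = 0
  · rw [hz, zero_add, ← hstable, mapDomain_inv_apply]
    exact hT _
  · rw [h z hz, add_zero]
    exact hT _

theorem exists_mul_root60_eq_one {η z : ℂ} (hη : η ≠ 0) {E : Finset (ZMod 60)}
    (h : rotatedSum η E z ≠ 0) (h' : rotatedSum η E z⁻¹ ≠ 0) : ∃ a ∈ E, ∃ b ∈ E, η ^ 2 * root60 (a + b) = 1 := by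
  obtain ⟨a, ha, rfl⟩ := (rotatedSum_ne_zero_iff E z).1 h
  obtain ⟨b, hb, hb'⟩ := (rotatedSum_ne_zero_iff E _).1 h'
  refine ⟨a, ha, b, hb, ?_⟩
  have hne : η * root60 a ≠ 0 := mul_ne_zero hη (root60_ne_zero a)
  rw [AddChar.map_add_eq_mul]
  calc η ^ 2 * (root60 a * root60 b) = η * root60 a * (η * root60 b) := by ring
    _ = 1 := by rw [hb', mul_inv_cancel₀ hne]

theorem mapDomain_inv_rotatedSum_regular {η z : ℂ} (hη : η ≠ 0) {E : Finset (ZMod 60)}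
    (hE : E ∈ regularExponents) (h : rotatedSum η E z ≠ 0) (h' : rotatedSum η E z⁻¹ ≠ 0) :
    (rotatedSum η E).mapDomain Inv.inv = rotatedSum η E := by
  obtain ⟨a, ha, b, hb, hab⟩ := exists_mul_root60_eq_one hη h h'
  have hclosed : ∀ E ∈ regularExponents, ∀ a ∈ E, ∀ b ∈ E, ∀ k ∈ E, a + b - k ∈ E := by
    intro E hE
    simp only [regularExponents, List.mem_cons, List.not_mem_nil, or_false] at hE
    rcases hE with rfl | rfl | rfl <;> decide +kernel
  refine mapDomain_inv_eq_self fun w hw => ?_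
  obtain ⟨k, hk, rfl⟩ := (rotatedSum_ne_zero_iff E w).1 hw
  have hinv : (η * root60 k)⁻¹ = η * root60 (a + b - k) := by
    refine inv_eq_of_mul_eq_one_right ?_
    calc η * root60 k * (η * root60 (a + b - k))
        = η ^ 2 * (root60 k * root60 (a + b - k)) := by ring
      _ = 1 := by rw [← AddChar.map_add_eq_mul, add_sub_cancel, hab]
  rw [hinv, rotatedSum_apply hη, rotatedSum_apply hη, if_pos hk,
    if_pos (hclosed E hE a ha b hb k hk)]

theorem exists_root60_eq_of_mixed {η z : ℂ} (hη : η ≠ 0)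
    (h : rotatedSum η mixedExponents z ≠ 0) (h' : rotatedSum η mixedExponents z⁻¹ ≠ 0) :
    ∃ a, η = root60 a := by
  obtain ⟨a, ha, b, hb, hab⟩ := exists_mul_root60_eq_one hη h h'
  have heven : ∀ a ∈ mixedExponents, ∀ b ∈ mixedExponents, ∃ c : ZMod 60, a + b = 2 * c := by
    decide +kernel
  obtain ⟨c, hc⟩ := heven a ha b hb
  have hsq : (η * root60 c) ^ 2 = 1 := by
    rw [mul_pow, root60_pow, Nat.cast_ofNat, ← hc, hab]
  have hinv : root60 c * root60 (-c) = 1 := by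
    rw [← AddChar.map_add_eq_mul, add_neg_cancel, AddChar.map_zero_eq_one]
  rcases sq_eq_one_iff.1 hsq with h1 | h1
  · exact ⟨-c, by linear_combination root60 (-c) * h1 - η * hinv⟩
  · refine ⟨30 + -c, ?_⟩
    rw [AddChar.map_add_eq_mul, root60_thirty]
    linear_combination root60 (-c) * h1 - η * hinv

theorem mapDomain_inv_rotatedSum_mixed (a : ZMod 60) :
    (rotatedSum (root60 a) mixedExponents).mapDomain Inv.inv =
      rotatedSum (root60 (-a)) mixedExponents := by
  have hneg : mixedExponents.image (- ·) = mixedExponents := by decide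
  rw [rotatedSum, Finsupp.mapDomain_finsetSum, rotatedSum]
  conv_rhs => rw [← hneg]
  rw [Finset.sum_image neg_injective.injOn]
  refine Finset.sum_congr rfl fun k _ => ?_
  rw [Finsupp.mapDomain_single, mul_inv, ← AddChar.map_neg_eq_inv, ← AddChar.map_neg_eq_inv]

theorem rotatedSum_root60_apply (a k : ZMod 60) (E : Finset (ZMod 60)) :
    rotatedSum (root60 a) E (root60 k) = if k - a ∈ E then 1 else 0 := by
  rw [← rotatedSum_apply (root60_ne_zero a), ← AddChar.map_add_eq_mul, add_sub_cancel]

theorem eq_neg_or_neg_eq_of_mixed : ∀ a b : ZMod 60,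
    (∀ k, ((if k - a ∈ mixedExponents then 1 else 0) + if k - b ∈ mixedExponents then 1 else 0) =
      (if -k - a ∈ mixedExponents then 1 else 0) + if -k - b ∈ mixedExponents then 1 else 0) →
      b = -a ∨ -a = a := by
  decide +kernel

/-- A conjugation-stable sum of two sums of mixed type contains, along with one of them, its
conjugate as a complementary summand, unless that one is itself conjugation-stable. -/
theorem mapDomain_inv_eq_or_add_le_of_mixed {η η' z z' : ℂ} (hη : η ≠ 0) (hη' : η' ≠ 0)
    {f : ℂ →₀ ℕ} (hstable : f.mapDomain Inv.inv = f)
    (hf : rotatedSum η mixedExponents + rotatedSum η' mixedExponents = f)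
    (hz : rotatedSum η mixedExponents z ≠ 0) (hz_inv : rotatedSum η mixedExponents z⁻¹ ≠ 0)
    (hz' : rotatedSum η' mixedExponents z' ≠ 0)
    (hz'_inv : rotatedSum η' mixedExponents z'⁻¹ ≠ 0) :
    (rotatedSum η mixedExponents).mapDomain Inv.inv = rotatedSum η mixedExponents ∨
      rotatedSum η mixedExponents + (rotatedSum η mixedExponents).mapDomain Inv.inv ≤ f := by
  obtain ⟨a, rfl⟩ := exists_root60_eq_of_mixed hη hz hz_inv
  obtain ⟨b, rfl⟩ := exists_root60_eq_of_mixed hη' hz' hz'_inv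
  have hab := eq_neg_or_neg_eq_of_mixed a b fun k => by
    have h := DFunLike.congr_fun hstable (root60 k)
    rw [mapDomain_inv_apply, ← AddChar.map_neg_eq_inv, ← hf] at h
    simpa only [Finsupp.add_apply, rotatedSum_root60_apply] using h.symm
  rw [mapDomain_inv_rotatedSum_mixed]
  rcases hab with rfl | h
  · exact .inr hf.le
  · exact .inl (by rw [h])

/-- A minimal vanishing sum of least weight inside a nonempty vanishing sum. -/
theorem IsVanishing.exists_degree_minimal {f : ℂ →₀ ℕ} (hf : IsVanishing f) (hf0 : f ≠ 0) :
    ∃ T ≤ f, T ≠ 0 ∧ rootSum T = 0 ∧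
      ∀ b ≤ f, b ≠ 0 → rootSum b = 0 → T.degree ≤ b.degree := by
  classical
  have hex : ∃ n, ∃ T ≤ f, T ≠ 0 ∧ rootSum T = 0 ∧ T.degree = n :=
    ⟨_, f, le_rfl, hf0, hf.sum_eq_zero, rfl⟩
  obtain ⟨T, hT, hT0, hsum, hdeg⟩ := Nat.find_spec hex
  refine ⟨T, hT, hT0, hsum, fun b hb hb0 hbs => ?_⟩
  rw [hdeg]
  exact Nat.find_min' hex ⟨b, hb, hb0, hbs, rfl⟩

theorem card_le_five_of_mem_regularExponents : ∀ E ∈ regularExponents, E.card ≤ 5 := by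
  intro E hE
  simp only [regularExponents, List.mem_cons, List.not_mem_nil, or_false] at hE
  rcases hE with rfl | rfl | rfl <;> decide

/-- A conjugation-stable vanishing sum of weight at most twelve which is not minimal contains a
minimal vanishing sum that is conjugation-stable or can be removed together with its conjugate. -/
theorem IsVanishing.exists_minimal_mapDomain_inv {f : ℂ →₀ ℕ} (hf : IsVanishing f) (hf0 : f ≠ 0)
    (hdeg : f.degree ≤ 12) (hstable : f.mapDomain Inv.inv = f) :
    ∃ T ≤ f, IsMinimalVanishing T ∧
      (T.mapDomain Inv.inv = T ∨ T + T.mapDomain Inv.inv ≤ f) := by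
  by_cases hfmin : IsMinimalVanishing f
  · exact ⟨f, le_rfl, hfmin, .inl hstable⟩
  obtain ⟨T, hTf, hT0, hTsum, hTle⟩ := hf.exists_degree_minimal hf0
  have hmin : ∀ b ≤ f, b ≠ 0 → rootSum b = 0 → b.degree ≤ T.degree → IsMinimalVanishing b := by
    intro b hb hb0 hbs hbd
    refine ⟨⟨exists_pow_of_le hf.exists_pow hb, hbs⟩, hb0, fun d hd hds => ?_⟩
    by_cases hd0 : d = 0
    · exact .inl hd0
    · exact .inr (Finsupp.eq_of_le_of_degree_le hd (hbd.trans (hTle d (hd.trans hb) hd0 hds)))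
  have hTmin := hmin T hTf hT0 hTsum le_rfl
  have hTne : T ≠ f := fun h => hfmin (h ▸ hTmin)
  have hsub0 : f - T ≠ 0 := fun h => hTne (le_antisymm hTf (tsub_eq_zero_iff_le.1 h))
  have hsubsum := (hf.sub hTf hTsum).sum_eq_zero
  have hsubdeg := Finsupp.degree_sub_add hTf
  have hTdeg := hTle _ tsub_le_self hsub0 hsubsum
  by_cases hdisj : ∀ z, T z ≠ 0 → T z⁻¹ = 0
  · exact ⟨T, hTf, hTmin, .inr (add_mapDomain_inv_le hstable hTf hdisj)⟩
  push Not at hdisj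
  obtain ⟨z, hz, hz_inv⟩ := hdisj
  obtain ⟨η, hη, ⟨E, hE, rfl⟩ | rfl⟩ := hTmin.eq_rotatedSum (by omega)
  · exact ⟨_, hTf, hTmin, .inl (mapDomain_inv_rotatedSum_regular hη hE hz hz_inv)⟩
  have hcard : (rotatedSum η mixedExponents).degree = 6 := by
    rw [degree_rotatedSum]
    decide
  have hT'min := hmin _ tsub_le_self hsub0 hsubsum (by omega)
  have hadd := add_tsub_cancel_of_le hTf
  by_cases hdisj' : ∀ z, (f - rotatedSum η mixedExponents) z ≠ 0 →
      (f - rotatedSum η mixedExponents) z⁻¹ = 0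
  · exact ⟨_, tsub_le_self, hT'min, .inr (add_mapDomain_inv_le hstable tsub_le_self hdisj')⟩
  push Not at hdisj'
  obtain ⟨z', hz', hz'_inv⟩ := hdisj'
  obtain ⟨η', hη', ⟨E, hE, h⟩ | h⟩ := hT'min.eq_rotatedSum (by omega)
  · have h5 := card_le_five_of_mem_regularExponents E hE
    rw [h, hcard, degree_rotatedSum] at hTdeg
    omega
  · rw [h] at hz' hz'_inv hadd
    exact ⟨_, hTf, hTmin,
      mapDomain_inv_eq_or_add_le_of_mixed hη hη' hstable hadd hz hz_inv hz' hz'_inv⟩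

theorem mapDomain_inv_sub {f g : ℂ →₀ ℕ} (hf : f.mapDomain (Inv.inv : ℂ → ℂ) = f)
    (hg : g.mapDomain (Inv.inv : ℂ → ℂ) = g) :
    (f - g).mapDomain (Inv.inv : ℂ → ℂ) = f - g := by
  ext z
  rw [mapDomain_inv_apply, Finsupp.tsub_apply, Finsupp.tsub_apply, ← mapDomain_inv_apply f,
    ← mapDomain_inv_apply g, hf, hg]

theorem IsVanishing.exists_decomposition {f : ℂ →₀ ℕ} (hf : IsVanishing f)
    (hdeg : f.degree ≤ 12) (hstable : f.mapDomain (Inv.inv : ℂ → ℂ) = f) :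
    ∃ M : Multiset (ℂ →₀ ℕ), M.sum = f ∧ (∀ b ∈ M, IsMinimalVanishing b) ∧
      M.map (Finsupp.mapDomain (Inv.inv : ℂ → ℂ)) = M := by
  induction hn : f.degree using Nat.strong_induction_on generalizing f with
  | _ n ih =>
  by_cases hf0 : f = 0
  · exact ⟨0, by simp [hf0]⟩
  have step : ∀ g ≤ f, g ≠ 0 → rootSum g = 0 → g.mapDomain (Inv.inv : ℂ → ℂ) = g →
      ∃ M : Multiset (ℂ →₀ ℕ), M.sum = f - g ∧ (∀ b ∈ M, IsMinimalVanishing b) ∧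
        M.map (Finsupp.mapDomain (Inv.inv : ℂ → ℂ)) = M := by
    intro g hg hg0 hgsum hgstable
    have h1 := Finsupp.degree_sub_add hg
    have h2 : g.degree ≠ 0 := fun h => hg0 ((Finsupp.degree_eq_zero_iff _).1 h)
    exact ih _ (by omega) (hf.sub hg hgsum) (by omega) (mapDomain_inv_sub hstable hgstable) rfl
  obtain ⟨T, hTf, hT, hTstable | hTle⟩ := hf.exists_minimal_mapDomain_inv hf0 hdeg hstable
  · obtain ⟨M, hsum, hM, hmap⟩ := step T hTf hT.ne_zero hT.sum_eq_zero hTstable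
    refine ⟨T ::ₘ M, ?_, ?_, ?_⟩
    · rw [Multiset.sum_cons, hsum, add_tsub_cancel_of_le hTf]
    · simpa using ⟨hT, hM⟩
    · rw [Multiset.map_cons, hmap, hTstable]
  · have hT' := hT.mapDomain_inv
    obtain ⟨M, hsum, hM, hmap⟩ := step _ hTle (fun h => hT.ne_zero (add_eq_zero.1 h).1)
      (by rw [map_add, hT.sum_eq_zero, hT'.sum_eq_zero, add_zero])
      (by rw [Finsupp.mapDomain_add, mapDomain_inv_mapDomain_inv, add_comm])
    refine ⟨T ::ₘ T.mapDomain Inv.inv ::ₘ M, ?_, ?_, ?_⟩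
    · rw [Multiset.sum_cons, Multiset.sum_cons, hsum, ← add_assoc, add_tsub_cancel_of_le hTle]
    · simpa using ⟨hT, hT', hM⟩
    · rw [Multiset.map_cons, Multiset.map_cons, hmap, mapDomain_inv_mapDomain_inv,
        Multiset.cons_swap]

/-- A conjugation-stable relation of weight at most 12 admits a decomposition
into minimal relations which is stable under complex conjugation as a multiset:
each minimal relation occurring is stable under conjugation, or is paired with
its conjugate.  (On roots of unity, complex conjugation is `η ↦ η⁻¹`, so the
conjugate of a relation `b` is `Finsupp.mapDomain Inv.inv b`.) -/
theorem conjugation_stable_decomposition (S : ZeroRelation) (hw : S.weight ≤ 12)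
    (hstable : ∀ η : ℂ, (∃ m : ℕ, 0 < m ∧ η ^ m = 1) → S.coeff η⁻¹ = S.coeff η) :
    ∃ M : Multiset (ℂ →₀ ℕ),
      M.sum = S.coeff ∧
      (∀ b ∈ M, ∃ r : ZeroRelation, r.coeff = b ∧ r.IsMinimal) ∧
      M.map (Finsupp.mapDomain (Inv.inv : ℂ → ℂ)) = M := by
  have hf : IsVanishing S.coeff := ⟨S.mem_rootsOfUnity, S.sum_zero⟩
  have hconj : S.coeff.mapDomain (Inv.inv : ℂ → ℂ) = S.coeff :=
    mapDomain_inv_eq_self fun z hz =>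
      hstable z (S.mem_rootsOfUnity z (Finsupp.mem_support_iff.2 hz))
  obtain ⟨M, hsum, hM, hmap⟩ := hf.exists_decomposition hw hconj
  refine ⟨M, hsum, fun b hb => ?_, hmap⟩
  have hb' := hM b hb
  exact ⟨⟨b, hb'.exists_pow, hb'.ne_zero, hb'.sum_eq_zero⟩, rfl, hb'.eq_zero_or_eq⟩
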